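/- Let a(n) be the coefficients of η(τ)^{16}/η(2τ)⁸ = Σ a(n)qⁿ. Then a(0)=1, a(1)=-16, a(2)=112, a(3)=-448, a(4)=1136; moreover a(n) ≡ 0 mod 16 for all n ≥ 1. -/

import Mathlib

/-- The Dedekind eta function. -/
noncomputable def dedekindEta (t : ℂ) : ℂ :=
  Complex.exp (Real.pi * Complex.I * t / 12) *
    ∏' n : ℕ, (1 - Complex.exp (2 * Real.pi * Complex.I * (n + 1) * t))

open PowerSeries in
/-- `HasDiskSum p f` says that the power series `p` converges to `f` on the open unit disk. -/
def HasDiskSum (p : PowerSeries ℂ) (f : ℂ → ℂ) : Prop :=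
  ∀ q : ℂ, ‖q‖ < 1 → HasSum (fun n ↦ coeff n p * q ^ n) (f q)

/-- The function `∏ (1 - qⁿ)`, the product being over `n ≥ 1`. -/
noncomputable def eulerProd (q : ℂ) : ℂ := ∏' n : ℕ, (1 - q ^ (n + 1))

open Complex in
theorem laurent_coeff_eq_zero {d : ℤ → ℂ}
    (hd : ∀ q : ℂ, q ≠ 0 → ‖q‖ < 1 → HasSum (fun n ↦ d n * q ^ n) 0) (m : ℤ) : d m = 0 := by
  set r : ℝ := 1 / 2 with hr
  have hr0 : 0 < r := by norm_num [hr]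
  have hint (k : ℤ) : (∮ z in C(0, r), z ^ k) = if k = -1 then 2 * Real.pi * I else 0 := by
    split_ifs with hk
    · simpa [hk] using circleIntegral.integral_sub_center_inv 0 hr0.ne'
    · simpa using circleIntegral.integral_sub_zpow_of_ne hk 0 0 r
  have hsum : Summable fun n ↦ ‖d n‖ * r ^ n := by
    have := (hd (r : ℂ) (by simpa using hr0.ne') (by norm_num [hr])).summable.norm
    simpa [abs_of_pos hr0] using this
  have hnorm (θ : ℝ) : ‖circleMap 0 r θ‖ = r := by simp [abs_of_pos hr0]
  have hne (θ : ℝ) : circleMap 0 r θ ≠ 0 := circleMap_ne_center hr0.ne'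
  have key : HasSum (fun n ↦ ∮ z in C(0, r), d n * z ^ (n - m - 1)) (∮ z in C(0, r), 0) := by
    unfold circleIntegral
    refine intervalIntegral.hasSum_integral_of_dominated_convergence
      (fun n _ ↦ ‖d n‖ * r ^ n * r ^ (-m)) (fun n ↦ ?_) (fun n ↦ ?_) ?_ ?_ ?_
    · refine Continuous.aestronglyMeasurable ?_
      simp only [deriv_circleMap, smul_eq_mul]
      exact ((continuous_circleMap 0 r).mul continuous_const).mul (continuous_const.mul
        ((continuous_circleMap 0 r).zpow₀ _ fun θ ↦ .inl (hne θ)))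
    · refine .of_forall fun θ _ ↦ le_of_eq ?_
      simp only [deriv_circleMap, smul_eq_mul, norm_mul, norm_zpow, hnorm, norm_I]
      rw [show n - m - 1 = n + -m + -1 by ring, zpow_add₀ hr0.ne', zpow_add₀ hr0.ne', zpow_neg_one]
      field_simp
    · exact .of_forall fun θ _ ↦ hsum.mul_right _
    · exact intervalIntegrable_const
    · refine .of_forall fun θ _ ↦ ?_
      have h1 := (hd _ (hne θ) (by rw [hnorm]; norm_num [hr])).mul_left
        (deriv (circleMap 0 r) θ * circleMap 0 r θ ^ (-m - 1))
      simp only [mul_zero, smul_zero] at h1 ⊢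
      convert! h1 using 2 with n
      rw [show n - m - 1 = n + (-m - 1) by ring, zpow_add₀ (hne θ), smul_eq_mul]
      ring
  simp only [circleIntegral.integral_const_mul, hint] at key
  have h2 := key.unique (hasSum_single m fun n hn ↦ by
    rw [if_neg (by omega), mul_zero])
  simpa [circleIntegral, Real.pi_ne_zero] using h2.symm

namespace HasDiskSum

open PowerSeries

variable {p p' : PowerSeries ℂ} {f g : ℂ → ℂ}

theorem hasSum_int (h : HasDiskSum p f) {q : ℂ} (hq : ‖q‖ < 1) :
    HasSum (fun n : ℤ ↦ (if 0 ≤ n then coeff n.toNat p else 0) * q ^ n) (f q) := by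
  rw [← (Nat.cast_injective (R := ℤ)).hasSum_iff]
  · simpa [Function.comp_def] using h q hq
  · intro n hn
    rw [if_neg, zero_mul]
    exact fun h0 ↦ hn ⟨n.toNat, by simp [h0]⟩

theorem laurent_coeff (h : HasDiskSum p f) {a : ℤ → ℂ}
    (ha : ∀ q : ℂ, q ≠ 0 → ‖q‖ < 1 → HasSum (fun n ↦ a n * q ^ n) (f q)) (n : ℕ) :
    a n = coeff n p := by
  have := laurent_coeff_eq_zero
    (d := fun n : ℤ ↦ a n - if 0 ≤ n then coeff n.toNat p else 0) (fun q h0 h1 ↦ by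
      simpa [sub_mul] using (ha q h0 h1).sub (h.hasSum_int h1)) n
  simpa [sub_eq_zero] using this

theorem unique (h : HasDiskSum p f) (h' : HasDiskSum p' f) : p = p' := by
  ext n
  simpa using h'.laurent_coeff (fun q _ hq ↦ h.hasSum_int hq) n

theorem mul (h : HasDiskSum p f) (h' : HasDiskSum p' g) :
    HasDiskSum (p * p') fun q ↦ f q * g q := by
  intro q hq
  have hs := (h q hq).summable.norm
  have hs' := (h' q hq).summable.norm
  have h1 := tsum_mul_tsum_eq_tsum_sum_antidiagonal_of_summable_norm hs hs'
  rw [(h q hq).tsum_eq, (h' q hq).tsum_eq] at h1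
  have h2 := (summable_norm_sum_mul_antidiagonal_of_summable_norm hs hs').of_norm.hasSum
  rw [← h1] at h2
  convert! h2 using 2 with n
  rw [coeff_mul, Finset.sum_mul]
  refine Finset.sum_congr rfl fun x hx ↦ ?_
  rw [← Finset.HasAntidiagonal.mem_antidiagonal.mp hx, pow_add]
  ring

theorem one : HasDiskSum 1 fun _ ↦ 1 := fun q _ ↦ by
  simpa using hasSum_single (f := fun n ↦ coeff n (1 : PowerSeries ℂ) * q ^ n) 0
    fun n hn ↦ by simp [coeff_one, hn]

theorem X_pow (k : ℕ) : HasDiskSum (X ^ k) fun q ↦ q ^ k := fun q _ ↦ by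
  convert hasSum_ite_eq k (q ^ k) using 2 with n
  rw [coeff_X_pow]
  split_ifs with h <;> simp [h]

theorem sub (h : HasDiskSum p f) (h' : HasDiskSum p' g) :
    HasDiskSum (p - p') fun q ↦ f q - g q := fun q hq ↦ by
  simpa [sub_mul] using (h q hq).sub (h' q hq)

theorem pow (h : HasDiskSum p f) (k : ℕ) : HasDiskSum (p ^ k) fun q ↦ f q ^ k := by
  induction k with
  | zero => simpa using one
  | succ k ih => simpa only [pow_succ] using ih.mul h

theorem prod {ι : Type*} (s : Finset ι) {P : ι → PowerSeries ℂ} {F : ι → ℂ → ℂ}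
    (h : ∀ i, HasDiskSum (P i) (F i)) : HasDiskSum (∏ i ∈ s, P i) fun q ↦ ∏ i ∈ s, F i q := by
  classical
  induction s using Finset.induction_on with
  | empty => simpa using one
  | insert i s hi ih => simpa only [Finset.prod_insert hi] using (h i).mul ih

theorem expand_two (h : HasDiskSum p f) :
    HasDiskSum (expand 2 two_ne_zero p) fun q ↦ f (q ^ 2) := by
  intro q hq
  rw [← (mul_right_injective₀ (two_ne_zero (α := ℕ))).hasSum_iff]
  · simpa [Function.comp_def, coeff_expand_mul, pow_mul] using
      h (q ^ 2) (by simpa using pow_lt_one₀ (norm_nonneg q) hq two_ne_zero)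
  · intro n hn
    rw [coeff_expand_of_not_dvd, zero_mul]
    exact fun ⟨k, hk⟩ ↦ hn ⟨k, hk.symm⟩

theorem of_differentiableOn (hf : DifferentiableOn ℂ f (Metric.ball 0 1)) :
    HasDiskSum (.mk fun n ↦ (n.factorial : ℂ)⁻¹ * iteratedDeriv n f 0) f := by
  intro q hq
  convert! Complex.hasSum_taylorSeries_on_ball hf (z := q) (by simpa using hq) using 2 with n
  rw [coeff_mk, sub_zero, smul_eq_mul, smul_eq_mul]
  ring

end HasDiskSum

open Filter Topology in
theorem TendstoLocallyUniformlyOn.iteratedDeriv {ι : Type*} {l : Filter ι} {F : ι → ℂ → ℂ}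
    {f : ℂ → ℂ} {U : Set ℂ} (hf : TendstoLocallyUniformlyOn F f l U)
    (hF : ∀ i, DifferentiableOn ℂ (F i) U) (hU : IsOpen U) (n : ℕ) :
    TendstoLocallyUniformlyOn (fun i ↦ iteratedDeriv n (F i)) (iteratedDeriv n f) l U := by
  have hd (i : ι) (k : ℕ) : DifferentiableOn ℂ (_root_.iteratedDeriv k (F i)) U := by
    induction k with
    | zero => simpa using hF i
    | succ k ih => simpa only [iteratedDeriv_succ] using ih.deriv hU
  induction n with
  | zero => simpa using hf
  | succ n ih =>
    simp only [iteratedDeriv_succ]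
    exact ih.deriv (.of_forall fun i ↦ hd i n) hU

open PowerSeries Filter Topology in
theorem hasDiskSum_eulerProd : HasDiskSum (pentagonalSeries ℂ) eulerProd := by
  have hd : DifferentiableOn ℂ eulerProd (Metric.ball 0 1) :=
    ModularForm.differentiableOn_tprod_one_sub_pow
  have hE := HasDiskSum.of_differentiableOn hd
  convert hE using 1
  ext n
  have hlim := ModularForm.multipliableLocallyUniformlyOn_one_sub_pow.hasProdLocallyUniformlyOn
  have hdiff (s : Finset ℕ) :
      DifferentiableOn ℂ (fun q : ℂ ↦ ∏ i ∈ s, (1 - q ^ (i + 1))) (Metric.ball 0 1) := by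
    fun_prop
  have h1 := ((hlim.iteratedDeriv hdiff Metric.isOpen_ball n).tendsto_at
    (Metric.mem_ball_self one_pos)).const_mul (n.factorial : ℂ)⁻¹
  rw [coeff_mk]
  refine tendsto_nhds_unique (tendsto_nhds_of_eventually_eq ?_) h1
  filter_upwards [coeff_prod_one_sub_X_pow_eventually_eq ℂ n] with s hs
  rw [← hs, ((HasDiskSum.of_differentiableOn (hdiff s)).unique
    (.prod s fun i ↦ HasDiskSum.one.sub (.X_pow (i + 1)))).symm, coeff_mk]

open PowerSeries in
theorem map_pentagonalSeries {R S : Type*} [CommRing R] [CommRing S] (φ : R →+* S) :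
    map φ (pentagonalSeries R) = pentagonalSeries S := by
  ext n
  by_cases hn : n ∈ Set.range pentagonal
  · obtain ⟨k, rfl⟩ := hn
    simp
  · simp [coeff_pentagonalSeries_eq_zero _ hn]

open PowerSeries in
theorem exists_sq_eq_expand_two_add (P : PowerSeries ℤ) :
    ∃ g, P ^ 2 = expand 2 two_ne_zero P + 2 * g := by
  have h : map (Int.castRingHom (ZMod 2)) (P ^ 2 - expand 2 two_ne_zero P) = 0 := by
    have h2 := MvPowerSeries.map_frobenius_expand 2 two_ne_zero
      (f := map (Int.castRingHom (ZMod 2)) P)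
    rw [ZMod.frobenius_zmod, MvPowerSeries.map_id, RingHom.id_apply] at h2
    rw [map_sub, map_pow, ← h2, map_expand]
    exact sub_self _
  refine ⟨.mk fun n ↦ coeff n (P ^ 2 - expand 2 two_ne_zero P) / 2, ?_⟩
  rw [← sub_eq_iff_eq_add']
  ext n
  have hn := congrArg (coeff n) h
  rw [coeff_map, eq_intCast, map_zero, ZMod.intCast_zmod_eq_zero_iff_dvd] at hn
  rw [show (2 : PowerSeries ℤ) = C 2 from (map_ofNat C 2).symm, coeff_C_mul, coeff_mk]
  exact (Int.mul_ediv_cancel' (by exact_mod_cast hn)).symm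

theorem eulerProd_ne_zero {q : ℂ} (hq : ‖q‖ < 1) : eulerProd q ≠ 0 := by
  simp only [eulerProd, sub_eq_add_neg]
  refine tprod_one_add_ne_zero_of_summable (f := fun n : ℕ ↦ -q ^ (n + 1)) (fun i h ↦ ?_) ?_
  · have : q ^ (i + 1) = 1 := by linear_combination -h
    have h2 := pow_lt_one₀ (norm_nonneg q) hq i.succ_ne_zero
    rw [← norm_pow, this] at h2
    simp at h2
  · simpa using! (summable_nat_add_iff 1).mpr (summable_geometric_of_lt_one (norm_nonneg _) hq)

open PowerSeries in
/-- The integral power series of `∏ (1 - qⁿ)² / (1 - q²ⁿ)`. -/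
theorem exists_theta_series :
    ∃ h g : PowerSeries ℤ, h * expand 2 two_ne_zero (pentagonalSeries ℤ) = pentagonalSeries ℤ ^ 2 ∧
      h = 1 + 2 * g := by
  obtain ⟨g, hg⟩ := exists_sq_eq_expand_two_add (pentagonalSeries ℤ)
  have hu : IsUnit (expand 2 two_ne_zero (pentagonalSeries ℤ)) := by
    rw [isUnit_iff_constantCoeff, constantCoeff_expand, ← coeff_zero_eq_constantCoeff_apply]
    simp [show coeff 0 (pentagonalSeries ℤ) = 1 by
      simpa [pentagonal] using coeff_pentagonalSeries_pentagonal ℤ 0,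
      -coeff_zero_eq_constantCoeff]
  obtain ⟨u, hu⟩ := hu.exists_left_inv
  refine ⟨1 + 2 * (g * u), g * u, ?_, rfl⟩
  linear_combination 2 * g * hu - hg

open PowerSeries in
theorem coeff_theta_series {h : PowerSeries ℤ}
    (hh : h * expand 2 two_ne_zero (pentagonalSeries ℤ) = pentagonalSeries ℤ ^ 2) :
    coeff 0 h = 1 ∧ coeff 1 h = -2 ∧ coeff 2 h = 0 ∧ coeff 3 h = 0 ∧ coeff 4 h = 2 := by
  have e0 : coeff 0 (pentagonalSeries ℤ) = 1 := by
    simpa [pentagonal] using coeff_pentagonalSeries_pentagonal ℤ 0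
  have e1 : coeff 1 (pentagonalSeries ℤ) = -1 := by
    simpa [pentagonal] using coeff_pentagonalSeries_pentagonal ℤ 1
  have e2 : coeff 2 (pentagonalSeries ℤ) = -1 := by
    simpa [pentagonal] using coeff_pentagonalSeries_pentagonal ℤ (-1)
  have hne (n : ℕ) (hn : n = 3 ∨ n = 4) : coeff n (pentagonalSeries ℤ) = 0 := by
    refine coeff_pentagonalSeries_eq_zero _ ?_
    rintro ⟨k, hk⟩
    have h1 := two_mul_natCast_pentagonal k
    have h2 : -2 < k := by rcases hn with rfl | rfl <;> rw [hk] at h1 <;> push_cast at h1 <;> nlinarith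
    have h3 : k < 2 := by rcases hn with rfl | rfl <;> rw [hk] at h1 <;> push_cast at h1 <;> nlinarith
    interval_cases k <;> omega
  have e3 := hne 3 (.inl rfl)
  have e4 := hne 4 (.inr rfl)
  have hc (n : ℕ) := congrArg (coeff n) hh
  have h0 := hc 0
  have h1 := hc 1
  have h2 := hc 2
  have h3 := hc 3
  have h4 := hc 4
  simp only [sq, coeff_mul, Finset.Nat.sum_antidiagonal_eq_sum_range_succ_mk, Finset.sum_range_succ,
    Finset.sum_range_zero, coeff_expand] at h0 h1 h2 h3 h4
  norm_num [e0, e1, e2, e3, e4, -coeff_zero_eq_constantCoeff] at h0 h1 h2 h3 h4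
  refine ⟨?_, ?_, ?_, ?_, ?_⟩ <;> linarith

open PowerSeries in
theorem coeff_pow_eight {h : PowerSeries ℤ}
    (hh : coeff 0 h = 1 ∧ coeff 1 h = -2 ∧ coeff 2 h = 0 ∧ coeff 3 h = 0 ∧ coeff 4 h = 2) :
    coeff 0 (h ^ 8) = 1 ∧ coeff 1 (h ^ 8) = -16 ∧ coeff 2 (h ^ 8) = 112 ∧
      coeff 3 (h ^ 8) = -448 ∧ coeff 4 (h ^ 8) = 1136 := by
  have hsq {k : PowerSeries ℤ} {x0 x1 x2 x3 x4 : ℤ} (hk : coeff 0 k = x0 ∧ coeff 1 k = x1 ∧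
      coeff 2 k = x2 ∧ coeff 3 k = x3 ∧ coeff 4 k = x4) :
      coeff 0 (k ^ 2) = x0 * x0 ∧ coeff 1 (k ^ 2) = 2 * x0 * x1 ∧
      coeff 2 (k ^ 2) = 2 * x0 * x2 + x1 * x1 ∧ coeff 3 (k ^ 2) = 2 * x0 * x3 + 2 * x1 * x2 ∧
      coeff 4 (k ^ 2) = 2 * x0 * x4 + 2 * x1 * x3 + x2 * x2 := by
    obtain ⟨rfl, rfl, rfl, rfl, rfl⟩ := hk
    simp only [sq, coeff_mul, Finset.Nat.sum_antidiagonal_eq_sum_range_succ_mk,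
      Finset.sum_range_succ, Finset.sum_range_zero]
    refine ⟨?_, ?_, ?_, ?_, ?_⟩ <;> norm_num [-coeff_zero_eq_constantCoeff] <;> ring
  simpa [← pow_mul, -coeff_zero_eq_constantCoeff] using hsq (hsq (hsq hh))

open PowerSeries in
theorem hasDiskSum_theta_pow_eight {h : PowerSeries ℤ}
    (hh : h * expand 2 two_ne_zero (pentagonalSeries ℤ) = pentagonalSeries ℤ ^ 2) :
    HasDiskSum (map (Int.castRingHom ℂ) (h ^ 8))
      fun q ↦ eulerProd q ^ 16 / eulerProd (q ^ 2) ^ 8 := by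
  have hd : DifferentiableOn ℂ eulerProd (Metric.ball 0 1) :=
    ModularForm.differentiableOn_tprod_one_sub_pow
  have hlt {q : ℂ} (hq : ‖q‖ < 1) : ‖q ^ 2‖ < 1 := by
    simpa using pow_lt_one₀ (norm_nonneg q) hq two_ne_zero
  have hne {q : ℂ} (hq : ‖q‖ < 1) : eulerProd (q ^ 2) ^ 8 ≠ 0 :=
    pow_ne_zero _ (eulerProd_ne_zero (hlt hq))
  have hF := HasDiskSum.of_differentiableOn
    (f := fun q ↦ eulerProd q ^ 16 / eulerProd (q ^ 2) ^ 8) <|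
    (hd.fun_pow 16).fun_div ((hd.comp (t := Metric.ball 0 1) (f := fun q : ℂ ↦ q ^ 2) (by fun_prop)
      fun q hq ↦ by simpa only [mem_ball_zero_iff] using hlt (by simpa using hq)).fun_pow 8)
      fun q hq ↦ hne (by simpa using hq)
  have h1 := hF.mul (hasDiskSum_eulerProd.expand_two.pow 8)
  have h2 : HasDiskSum (pentagonalSeries ℂ ^ 16) fun q ↦
      eulerProd q ^ 16 / eulerProd (q ^ 2) ^ 8 * eulerProd (q ^ 2) ^ 8 := fun q hq ↦ by
    simpa only [div_mul_cancel₀ _ (hne hq)] using hasDiskSum_eulerProd.pow 16 q hq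
  have h3 := h1.unique h2
  have h4 := congrArg (map (Int.castRingHom ℂ)) hh
  rw [map_mul, map_expand, map_pow, map_pentagonalSeries] at h4
  convert hF using 1
  refine mul_right_cancel₀ (pow_ne_zero 8 ?_) (Eq.trans ?_ h3.symm)
  · intro h0
    rw [h0, mul_zero] at h4
    have h5 := congrArg (coeff 0) (pow_eq_zero_iff two_ne_zero |>.mp h4.symm)
    have h6 : coeff 0 (pentagonalSeries ℂ) = 1 := by
      simpa [pentagonal] using coeff_pentagonalSeries_pentagonal ℂ 0
    simp [h6, -coeff_zero_eq_constantCoeff] at h5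
  · rw [map_pow, ← mul_pow, h4, ← pow_mul]

open Complex in
theorem dedekindEta_quotient (τ : ℂ) :
    dedekindEta τ ^ 16 / dedekindEta (2 * τ) ^ 8 =
      eulerProd (exp (2 * Real.pi * I * τ)) ^ 16 / eulerProd (exp (2 * Real.pi * I * τ) ^ 2) ^ 8 := by
  have h1 (t : ℂ) : dedekindEta t =
      exp (Real.pi * I * t / 12) * eulerProd (exp (2 * Real.pi * I * t)) := by
    simp only [dedekindEta, eulerProd, ← exp_nat_mul]
    congr! 5 with n
    push_cast
    ring
  rw [h1, h1, mul_pow, mul_pow, ← exp_nat_mul, ← exp_nat_mul, ← exp_nat_mul,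
    show (2 : ℕ) * (2 * Real.pi * I * τ) = 2 * Real.pi * I * (2 * τ) by push_cast; ring,
    show (8 : ℕ) * (Real.pi * I * (2 * τ) / 12) = (16 : ℕ) * (Real.pi * I * τ / 12) by
      push_cast; ring]
  exact mul_div_mul_left _ _ (exp_ne_zero _)

/-- The coefficients of `η(τ)¹⁶/η(2τ)⁸ = Σ a(n)qⁿ` satisfy `a(0)=1, a(1)=-16, a(2)=112,`
`a(3)=-448, a(4)=1136`, and `16 ∣ a(n)` for all `n ≥ 1`. -/
theorem stmt19 (a : ℤ → ℂ)
    (h : ∀ τ : ℂ, 0 < τ.im →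
      dedekindEta τ ^ 16 / dedekindEta (2 * τ) ^ 8 =
        ∑' n : ℤ, a n * Complex.exp (2 * Real.pi * Complex.I * τ) ^ n) :
    a 0 = 1 ∧ a 1 = -16 ∧ a 2 = 112 ∧ a 3 = -448 ∧ a 4 = 1136 ∧
      ∀ n : ℤ, 1 ≤ n → ∃ k : ℤ, a n = 16 * k := by
  have hF (q : ℂ) (h0 : q ≠ 0) (hq : ‖q‖ < 1) :
      HasSum (fun n ↦ a n * q ^ n) (eulerProd q ^ 16 / eulerProd (q ^ 2) ^ 8) := by
    obtain ⟨τ, hτ, rfl⟩ : ∃ τ : ℂ, 0 < τ.im ∧ Complex.exp (2 * Real.pi * Complex.I * τ) = q := by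
      refine ⟨Complex.log q / (2 * Real.pi * Complex.I), ?_, ?_⟩
      · have := Real.log_neg (norm_pos_iff.mpr h0) hq
        rw [show Complex.log q / (2 * Real.pi * Complex.I) =
            ((2 * Real.pi)⁻¹ : ℝ) * (-(Complex.I * Complex.log q)) by
          push_cast
          rw [div_eq_mul_inv, mul_inv, Complex.inv_I]
          ring, Complex.im_ofReal_mul]
        refine mul_pos (by positivity) ?_
        simpa [Complex.log_re] using this
      · rw [mul_div_cancel₀ _ Complex.two_pi_I_ne_zero, Complex.exp_log h0]
    have h1 := h τ hτ
    rw [dedekindEta_quotient] at h1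
    have hne : eulerProd (Complex.exp (2 * Real.pi * Complex.I * τ)) ^ 16 /
        eulerProd (Complex.exp (2 * Real.pi * Complex.I * τ) ^ 2) ^ 8 ≠ 0 :=
      div_ne_zero (pow_ne_zero _ (eulerProd_ne_zero hq)) (pow_ne_zero _ (eulerProd_ne_zero
        (by rw [norm_pow]; exact pow_lt_one₀ (norm_nonneg _) hq two_ne_zero)))
    rw [h1]
    refine Summable.hasSum (by_contra fun hs ↦ hne ?_)
    rw [h1, tsum_eq_zero_of_not_summable hs]
  obtain ⟨t, g, ht, rfl⟩ := exists_theta_series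
  have ha (n : ℕ) : a n = (((1 + 2 * g) ^ 8).coeff n : ℤ) := by
    simpa only [PowerSeries.coeff_map, eq_intCast] using
      (hasDiskSum_theta_pow_eight ht).laurent_coeff hF n
  obtain ⟨c0, c1, c2, c3, c4⟩ := coeff_pow_eight (coeff_theta_series ht)
  refine ⟨by simpa [c0, -PowerSeries.coeff_zero_eq_constantCoeff] using ha 0,
    by simpa [c1] using ha 1, by simpa [c2] using ha 2, by simpa [c3] using ha 3,
    by simpa [c4] using ha 4, fun n hn ↦ ?_⟩
  lift n to ℕ using by omega
  have hexp : ∃ k, (1 + 2 * g) ^ 8 = 1 + PowerSeries.C 16 * k := by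
    rw [map_ofNat]
    exact ⟨g + 7 * g ^ 2 + 28 * g ^ 3 + 70 * g ^ 4 + 112 * g ^ 5 + 112 * g ^ 6 + 64 * g ^ 7
      + 16 * g ^ 8, by ring⟩
  obtain ⟨k, hk⟩ := hexp
  refine ⟨k.coeff n, ?_⟩
  rw [ha, hk, map_add, PowerSeries.coeff_C_mul, PowerSeries.coeff_one, if_neg (by omega)]
  push_cast
  ring
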